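/- arXiv:1311.1331 — 2 statements merged into one kernel-verified Lean document; each statement's English description precedes it below -/
import Mathlib

section
/- Fix a domain Ω'' ⊂⊂ Ω' and set C_* := 2·osc_{cl Ω'} u + 2 and t₀ := dist²(Ω'', ∂Ω')/(4C_*). For each t ∈ (0,t₀): (i) the function (x,λ) ↦ L_{t,λ}(x) is lower semi-continuous on Ω''×[0,1]; (ii) for each λ ∈ [0,1], ‖L_{t,λ}‖_{L^∞(Ω'')} ≤ √(C_*·t). -/
open MeasureTheory Metric Filter Set Asymptotics
open scoped Topology ENNReal NNReal

noncomputable section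

namespace Paper

/-- A unit-speed geodesic of length `L`. -/
def IsUnitGeodesic {M : Type*} [MetricSpace M] (γ : ℝ → M) (L : ℝ) : Prop :=
  0 ≤ L ∧ ∀ s ∈ Set.Icc (0:ℝ) L, ∀ t ∈ Set.Icc (0:ℝ) L, dist (γ s) (γ t) = |s - t|

/-- A geodesic metric space: every pair of points is joined by a unit-speed
shortest geodesic. -/
def GeodesicSpace (M : Type*) [MetricSpace M] : Prop :=
  ∀ x y : M, ∃ γ : ℝ → M, IsUnitGeodesic γ (dist x y) ∧ γ 0 = x ∧ γ (dist x y) = y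

/-- The comparison angle `∠̃_k` in the model plane `𝕄²_k` at the vertex between two
sides of lengths `a`, `b` whose opposite side has length `c`, given by the law of
cosines in the model plane of constant curvature `k`. -/
def cmpAngle (k a b c : ℝ) : ℝ :=
  if k = 0 then Real.arccos ((a ^ 2 + b ^ 2 - c ^ 2) / (2 * a * b))
  else if k < 0 then
    Real.arccos ((Real.cosh (Real.sqrt (-k) * a) * Real.cosh (Real.sqrt (-k) * b) -
        Real.cosh (Real.sqrt (-k) * c)) /
      (Real.sinh (Real.sqrt (-k) * a) * Real.sinh (Real.sqrt (-k) * b)))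
  else
    Real.arccos ((Real.cos (Real.sqrt k * c) -
        Real.cos (Real.sqrt k * a) * Real.cos (Real.sqrt k * b)) /
      (Real.sin (Real.sqrt k * a) * Real.sin (Real.sqrt k * b)))

/-- A (complete, locally compact) geodesic space has curvature `≥ k` in the sense of
Alexandrov: near every point, comparison angles along pairs of geodesics issuing from a common
point are non-increasing in each of the two parameters. -/
structure CurvBddBelow (M : Type*) [MetricSpace M] (k : ℝ) : Prop where
  locallyCompact : LocallyCompactSpace M
  geodesic : GeodesicSpace M
  comparison : ∀ x : M, ∃ U ∈ 𝓝 x,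
    ∀ (p : M) (γ σ : ℝ → M) (L₁ L₂ : ℝ),
      IsUnitGeodesic γ L₁ → IsUnitGeodesic σ L₂ →
      (∀ s ∈ Set.Icc (0:ℝ) L₁, γ s ∈ U) → (∀ t ∈ Set.Icc (0:ℝ) L₂, σ t ∈ U) →
      γ 0 = p → σ 0 = p →
      ∀ s t s' t' : ℝ, 0 < s → s ≤ s' → s' ≤ L₁ → 0 < t → t ≤ t' → t' ≤ L₂ →
        cmpAngle k s' t' (dist (γ s') (σ t')) ≤ cmpAngle k s t (dist (γ s) (σ t))

/-- An `n`-dimensional Alexandrov space with curvature `≥ k` (without boundary);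
its Hausdorff dimension equals `n` and it carries the `n`-dimensional Hausdorff
measure `μH[n]` as its volume. -/
structure AlexandrovSpace (M : Type*) [MetricSpace M] (n : ℕ) (k : ℝ) : Prop where
  curv : CurvBddBelow M k
  dim : dimH (Set.univ : Set M) = n

/-- An NPC space: a complete geodesic space which is globally non-positively curved in
the sense of Alexandrov (CAT(0)); the comparison inequality `d(P,S) ≤ |P̄S̄|` for the
midpoint `S` of the side `QR` is expressed through the Euclidean median formula. -/
structure NPCSpace (Y : Type*) [MetricSpace Y] : Prop where
  complete : CompleteSpace Y
  geodesic : GeodesicSpace Y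
  cat0 : ∀ p q r m : Y, dist q m = dist q r / 2 → dist r m = dist q r / 2 →
    dist p m ^ 2 ≤ (dist p q ^ 2 + dist p r ^ 2) / 2 - dist q r ^ 2 / 4

/-- `Lip_0(Ω)`: Lipschitz functions with compact support contained in `Ω`. -/
def IsLip0 {M : Type*} [MetricSpace M] (Ω : Set M) (φ : M → ℝ) : Prop :=
  (∃ c : ℝ≥0, LipschitzWith c φ) ∧ IsCompact (tsupport φ) ∧ tsupport φ ⊆ Ω

/-- `C_0(Ω)`: continuous functions with compact support contained in `Ω`. -/
def IsC0 {M : Type*} [MetricSpace M] (Ω : Set M) (φ : M → ℝ) : Prop :=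
  Continuous φ ∧ IsCompact (tsupport φ) ∧ tsupport φ ⊆ Ω

/-- `A ⊂⊂ B` : `A` is compactly contained in `B`. -/
def CptIn {M : Type*} [TopologicalSpace M] (A B : Set M) : Prop :=
  IsCompact (closure A) ∧ closure A ⊆ B

/-- An abstract first-order Sobolev calculus on the metric measure space `(M, d, μ)`:
it records the Sobolev spaces `W^{1,2}(Ω)`, `W^{1,2}_0(Ω)` and the pointwise inner
product of weak gradients `⟨∇f, ∇g⟩`, with the basic compatibility properties. -/
structure SobolevFramework (M : Type*) [MetricSpace M] [MeasurableSpace M]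
    (μ : Measure M) where
  memW12 : Set M → (M → ℝ) → Prop
  memW12_0 : Set M → (M → ℝ) → Prop
  innerGrad : (M → ℝ) → (M → ℝ) → M → ℝ
  innerGrad_symm : ∀ f g, innerGrad f g = innerGrad g f
  innerGrad_add_left : ∀ f g h, innerGrad (f + g) h = innerGrad f h + innerGrad g h
  innerGrad_smul_left : ∀ (c : ℝ) (f g : M → ℝ),
    innerGrad (fun x => c * f x) g = fun x => c * innerGrad f g x
  innerGrad_nonneg : ∀ f x, 0 ≤ innerGrad f f x
  innerGrad_lip_le : ∀ (f : M → ℝ) (c : ℝ≥0), LipschitzWith c f →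
    ∀ x, innerGrad f f x ≤ (c : ℝ) ^ 2
  lip_memW12 : ∀ (Ω : Set M) (f : M → ℝ), Bornology.IsBounded Ω →
    (∃ c : ℝ≥0, LipschitzWith c f) → memW12 Ω f
  lip0_memW12_0 : ∀ (Ω : Set M) (f : M → ℝ), IsLip0 Ω f → memW12_0 Ω f
  memW12_0_sub : ∀ (Ω : Set M) (f : M → ℝ), memW12_0 Ω f → memW12 Ω f

variable {M : Type*} [MetricSpace M] [MeasurableSpace M] {μ : Measure M}

/-- `f ∈ W^{1,2}_loc(Ω)`. -/
def memW12loc (F : SobolevFramework M μ) (Ω : Set M) (f : M → ℝ) : Prop :=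
  ∀ Ω' : Set M, IsOpen Ω' → CptIn Ω' Ω → F.memW12 Ω' f

/-- `f` is a super-solution of the Poisson equation `𝓛_f = h·vol` on `Ω`:
`𝓛_f(φ) = -∫_Ω ⟨∇f,∇φ⟩ ≤ ∫_Ω hφ` for all nonnegative `φ ∈ Lip_0(Ω)`. -/
def IsSupersolution (F : SobolevFramework M μ) (Ω : Set M) (f h : M → ℝ) : Prop :=
  ∀ φ : M → ℝ, IsLip0 Ω φ → (∀ x, 0 ≤ φ x) →
    -∫ x in Ω, F.innerGrad f φ x ∂μ ≤ ∫ x in Ω, h x * φ x ∂μ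

/-- `f` is a sub-solution of the Poisson equation `𝓛_f = h·vol` on `Ω`. -/
def IsSubsolution (F : SobolevFramework M μ) (Ω : Set M) (f h : M → ℝ) : Prop :=
  ∀ φ : M → ℝ, IsLip0 Ω φ → (∀ x, 0 ≤ φ x) →
    ∫ x in Ω, h x * φ x ∂μ ≤ -∫ x in Ω, F.innerGrad f φ x ∂μ

/-- `f` is a weak solution of `𝓛_f = h·vol` on `Ω`. -/
def IsWeakSolution (F : SobolevFramework M μ) (Ω : Set M) (f h : M → ℝ) : Prop :=
  IsSupersolution F Ω f h ∧ IsSubsolution F Ω f h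

/-- The normalizing constant `c_{n,p} = ∫_{𝕊^{n-1}} |x¹|^p dσ
    = 2 π^{(n-1)/2} Γ((p+1)/2) / Γ((n+p)/2)`. -/
def cnp (n : ℕ) (p : ℝ) : ℝ :=
  2 * Real.pi ^ (((n : ℝ) - 1) / 2) * Real.Gamma ((p + 1) / 2) /
    Real.Gamma (((n : ℝ) + p) / 2)

/-- `ω_{n-1}`, the volume of the standard unit sphere `𝕊^{n-1} ⊂ ℝⁿ`. -/
def sphereVol (n : ℕ) : ℝ := 2 * Real.pi ^ ((n : ℝ) / 2) / Real.Gamma ((n : ℝ) / 2)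

variable {Y : Type*} [MetricSpace Y]

/-- The approximating energy density
`e^u_{p,ε}(x) = ((n+p)/(c_{n,p} ε^{n+p})) ∫_{B_x(ε)∩Ω} d_Y^p(u(x),u(y)) dμ(y)`. -/
def ksDensity (n : ℕ) (p : ℝ) (μ : Measure M) (Ω : Set M) (u : M → Y) (ε : ℝ)
    (x : M) : ℝ :=
  ((n : ℝ) + p) / (cnp n p * ε ^ ((n : ℝ) + p)) *
    ∫ y in Metric.ball x ε ∩ Ω, dist (u x) (u y) ^ p ∂μ

/-- The approximating energy `E^u_{p,ε}(φ) = ∫_Ω φ e^u_{p,ε} dμ`. -/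
def ksApproxEnergy (n : ℕ) (p : ℝ) (μ : Measure M) (Ω : Set M) (u : M → Y)
    (φ : M → ℝ) (ε : ℝ) : ℝ :=
  ∫ x in Ω, φ x * ksDensity n p μ Ω u ε x ∂μ

/-- Membership in the Korevaar-Schoen type Sobolev space `W^{1,p}(Ω,Y)`:
`u ∈ L^p(Ω,Y)` is Borel with separable range, the energy functional
`E^u_p(φ) = lim_{ε→0⁺} E^u_{p,ε}(φ)` exists for every `φ ∈ C_0(Ω)`, and the total
energy `sup {E^u_p(φ) : φ ∈ C_0(Ω), 0 ≤ φ ≤ 1}` is finite. -/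
def MemKS (n : ℕ) (p : ℝ) (μ : Measure M) (Ω : Set M) (u : M → Y) : Prop :=
  (∀ P : Y, Measurable fun x => dist (u x) P) ∧
  TopologicalSpace.IsSeparable (Set.range u) ∧
  (∃ P : Y, IntegrableOn (fun x => dist (u x) P ^ p) Ω μ) ∧
  (∀ φ : M → ℝ, IsC0 Ω φ → ∃ e : ℝ,
    Tendsto (fun ε => ksApproxEnergy n p μ Ω u φ ε) (𝓝[>] (0:ℝ)) (𝓝 e)) ∧
  ∃ C : ℝ, ∀ (φ : M → ℝ) (e : ℝ), IsC0 Ω φ → (∀ x, 0 ≤ φ x ∧ φ x ≤ 1) →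
    Tendsto (fun ε => ksApproxEnergy n p μ Ω u φ ε) (𝓝[>] (0:ℝ)) (𝓝 e) → e ≤ C

/-- The total energy `E^u_p = sup {E^u_p(φ) : φ ∈ C_0(Ω), 0 ≤ φ ≤ 1}`. -/
def ksEnergy (n : ℕ) (p : ℝ) (μ : Measure M) (Ω : Set M) (u : M → Y) : ℝ :=
  sSup { e : ℝ | ∃ φ : M → ℝ, IsC0 Ω φ ∧ (∀ x, 0 ≤ φ x ∧ φ x ≤ 1) ∧
    Tendsto (fun ε => ksApproxEnergy n p μ Ω u φ ε) (𝓝[>] (0:ℝ)) (𝓝 e) }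

/-- `ν` is the (finite Borel) energy measure `E^u_p` of `u` on `Ω`:
`E^u_{p,ε}(φ) → ∫ φ dν` for every nonnegative `φ ∈ C_0(Ω)`. -/
def IsEnergyMeasure (n : ℕ) (p : ℝ) (μ : Measure M) (Ω : Set M) (u : M → Y)
    (ν : Measure M) : Prop :=
  IsFiniteMeasure ν ∧
  ∀ φ : M → ℝ, IsC0 Ω φ → (∀ x, 0 ≤ φ x) →
    Tendsto (fun ε => ksApproxEnergy n p μ Ω u φ ε) (𝓝[>] (0:ℝ)) (𝓝 (∫ x, φ x ∂ν))

/-- `|∇u|_p`, the density of the absolutely continuous part of the energy measure `ν`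
with respect to `μ` (the Radon–Nikodym derivative). -/
def ksDens (μ ν : Measure M) (x : M) : ℝ := (ν.rnDeriv μ x).toReal

/-- `u` is a harmonic map: `u ∈ W^{1,2}(Ω,Y)` minimizes the energy `E^w_2` among all
`w ∈ W^{1,2}(Ω,Y)` with `d_Y(w(·),u(·)) ∈ W^{1,2}_0(Ω)`. -/
def IsHarmonicMap (F : SobolevFramework M μ) (n : ℕ) (Ω : Set M) (u : M → Y) : Prop :=
  MemKS n 2 μ Ω u ∧
  ∀ w : M → Y, MemKS n 2 μ Ω w → F.memW12_0 Ω (fun x => dist (w x) (u x)) →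
    ksEnergy n 2 μ Ω u ≤ ksEnergy n 2 μ Ω w

/-- The oscillation `osc_A u = max_{x,y ∈ A} d_Y(u(x),u(y))`. -/
def oscOn (u : M → Y) (A : Set M) : ℝ :=
  sSup { d : ℝ | ∃ x ∈ A, ∃ y ∈ A, d = dist (u x) (u y) }

/-- The pointwise Lipschitz constant `Lip u(x) = limsup_{y→x} d_Y(u(x),u(y))/|xy|`. -/
def pLipMap (u : M → Y) (x : M) : ℝ :=
  Filter.limsup (fun y => dist (u x) (u y) / dist x y) (𝓝[≠] x)

/-- The volume `vol(Σ_x)` of the space of directions at `x`, recovered as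
`lim_{r→0⁺} n · vol(B_x(r)) / rⁿ`. -/
def dirVolume (μ : Measure M) (n : ℕ) (x : M) : ℝ :=
  limUnder (𝓝[>] (0:ℝ)) (fun r => (n : ℝ) * (μ (Metric.ball x r)).toReal / r ^ n)

/-- The model function `s_k`. -/
def snk (k r : ℝ) : ℝ :=
  if k < 0 then Real.sinh (Real.sqrt (-k) * r) / Real.sqrt (-k)
  else if k = 0 then r
  else Real.sin (Real.sqrt k * r) / Real.sqrt k

/-- The set `M^δ = {x : vol(Σ_x) > (1-δ)·vol(𝕊^{n-1})}` of `δ`-regular points. -/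
def Mdelta (μ : Measure M) (n : ℕ) (δ : ℝ) : Set M :=
  { x : M | (1 - δ) * sphereVol n < dirVolume μ n x }

/-- The auxiliary function
`f_t(x,λ) = inf_{y∈Ω'} { e^{-2nkλ} |xy|²/(2t) - d_Y(u(x),u(y)) }`. -/
def auxF (n : ℕ) (k : ℝ) (u : M → Y) (Ω' : Set M) (t : ℝ) (x : M) (l : ℝ) : ℝ :=
  sInf { v : ℝ | ∃ y ∈ Ω',
    v = Real.exp (-2 * (n : ℝ) * k * l) * dist x y ^ 2 / (2 * t) - dist (u x) (u y) }

/-- The set `S_t(x,λ)` of points realizing the infimum defining `f_t(x,λ)`. -/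
def auxS (n : ℕ) (k : ℝ) (u : M → Y) (Ω' : Set M) (t : ℝ) (l : ℝ) (x : M) : Set M :=
  { y ∈ Ω' | auxF n k u Ω' t x l
      = Real.exp (-2 * (n : ℝ) * k * l) * dist x y ^ 2 / (2 * t) - dist (u x) (u y) }

/-- `L_{t,λ}(x) = dist(x, S_t(x,λ))`. -/
def auxL (n : ℕ) (k : ℝ) (u : M → Y) (Ω' : Set M) (t : ℝ) (l : ℝ) (x : M) : ℝ :=
  Metric.infDist x (auxS n k u Ω' t l x)

/-- Distance between two sets. -/
def setDist (A B : Set M) : ℝ := sInf { d : ℝ | ∃ x ∈ A, ∃ y ∈ B, d = dist x y }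

/-- `g` is a (weak) super-solution of the heat equation `𝓛_g = ∂g/∂λ` on the parabolic
cylinder `Q = G×I`: `-∫_Q ⟨∇g,∇φ⟩ dν ≤ ∫_Q (∂g/∂λ)φ dν` for all nonnegative
`φ ∈ Lip_0(Q)`, with `ν = μ × 𝓛¹` and spatial weak gradients. -/
def IsHeatSupersolution (F : SobolevFramework M μ) (G : Set M) (I : Set ℝ)
    (g : M × ℝ → ℝ) : Prop :=
  ∀ φ : M × ℝ → ℝ, IsLip0 (G ×ˢ I) φ → (∀ z, 0 ≤ φ z) →
    -∫ z in G ×ˢ I, F.innerGrad (fun x => g (x, z.2)) (fun x => φ (x, z.2)) z.1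
        ∂(μ.prod volume) ≤
      ∫ z in G ×ˢ I, deriv (fun s => g (z.1, s)) z.2 * φ z ∂(μ.prod volume)

/-- `g` is a (weak) sub-solution of the heat equation `𝓛_g = ∂g/∂λ` on `Q = G×I`. -/
def IsHeatSubsolution (F : SobolevFramework M μ) (G : Set M) (I : Set ℝ)
    (g : M × ℝ → ℝ) : Prop :=
  ∀ φ : M × ℝ → ℝ, IsLip0 (G ×ˢ I) φ → (∀ z, 0 ≤ φ z) →
    ∫ z in G ×ˢ I, deriv (fun s => g (z.1, s)) z.2 * φ z ∂(μ.prod volume) ≤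
      -∫ z in G ×ˢ I, F.innerGrad (fun x => g (x, z.2)) (fun x => φ (x, z.2)) z.1
        ∂(μ.prod volume)

/-- `|∇⁺v|(x) = limsup_{r→0} sup_{y∈B_x(r)} (v(y)-v(x))_+ / r`. -/
def upGrad (v : M → ℝ) (x : M) : ℝ :=
  Filter.limsup
    (fun r => sSup { d : ℝ | ∃ y ∈ Metric.ball x r, d = max (v y - v x) 0 / r })
    (𝓝[>] (0:ℝ))

end Paper

namespace Paper

/-- The function of `y` minimized in the definition of `auxF`, with `z = (x, λ)`. -/
def auxCost {M Y : Type*} [MetricSpace M] [MetricSpace Y] (n : ℕ) (k : ℝ) (u : M → Y) (t : ℝ)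
    (z : M × ℝ) (y : M) : ℝ :=
  Real.exp (-2 * (n : ℝ) * k * z.2) * dist z.1 y ^ 2 / (2 * t) - dist (u z.1) (u y)

section Auxiliary

variable {M : Type*} [MetricSpace M] {Y : Type*} [MetricSpace Y]

lemma dist_le_oscOn {u : M → Y} {K : Set M} (hK : IsCompact K) (hu : ContinuousOn u K)
    {x y : M} (hx : x ∈ K) (hy : y ∈ K) : dist (u x) (u y) ≤ oscOn u K := by
  refine le_csSup ⟨diam (u '' K), ?_⟩ ⟨x, hx, y, hy, rfl⟩
  rintro _ ⟨a, ha, b, hb, rfl⟩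
  exact dist_le_diam_of_mem (hK.image_of_continuousOn hu).isBounded
    (mem_image_of_mem u ha) (mem_image_of_mem u hb)

lemma bddBelow_dist_set (A B : Set M) :
    BddBelow {d : ℝ | ∃ x ∈ A, ∃ y ∈ B, d = dist x y} := by
  refine ⟨0, ?_⟩
  rintro _ ⟨x, -, y, -, rfl⟩
  exact dist_nonneg

lemma setDist_le_dist {A B : Set M} {x y : M} (hx : x ∈ A) (hy : y ∈ B) :
    setDist A B ≤ dist x y :=
  csInf_le (bddBelow_dist_set A B) ⟨x, hx, y, hy, rfl⟩

lemma setDist_nonneg (A B : Set M) : 0 ≤ setDist A B := by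
  refine Real.sInf_nonneg ?_
  rintro _ ⟨x, -, y, -, rfl⟩
  exact dist_nonneg

variable {n : ℕ} {k t : ℝ} {u : M → Y}

lemma auxCost_self (x : M) (l : ℝ) : auxCost n k u t (x, l) x = 0 := by
  simp [auxCost]

/-- Continuity of `auxCost` in all variables, along a filter. -/
lemma tendsto_auxCost {ι : Type*} {f : Filter ι} {z : ι → M × ℝ} {y : ι → M} {z₀ : M × ℝ} {y₀ : M}
    (hz : Tendsto z f (𝓝 z₀)) (hy : Tendsto y f (𝓝 y₀))
    (huz : ContinuousAt u z₀.1) (huy : ContinuousAt u y₀) :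
    Tendsto (fun i => auxCost n k u t (z i) (y i)) f (𝓝 (auxCost n k u t z₀ y₀)) := by
  have h1 : Tendsto (fun i => (z i).1) f (𝓝 z₀.1) := (continuous_fst.tendsto z₀).comp hz
  have h2 : Tendsto (fun i => (z i).2) f (𝓝 z₀.2) := (continuous_snd.tendsto z₀).comp hz
  have h3 := (Real.continuous_exp.tendsto _).comp (h2.const_mul (-2 * (n : ℝ) * k))
  exact ((h3.mul ((h1.dist hy).pow 2)).div_const (2 * t)).sub
    ((huz.tendsto.comp h1).dist (huy.tendsto.comp hy))

/-- A point whose cost is nonpositive lies at controlled distance from `x`. -/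
lemma dist_sq_le_of_auxCost_nonpos (hk : k ≤ 0) (ht : 0 < t) {x y : M} {l : ℝ} (hl : 0 ≤ l)
    (h : auxCost n k u t (x, l) y ≤ 0) : dist x y ^ 2 ≤ 2 * t * dist (u x) (u y) := by
  have hexp : 1 ≤ Real.exp (-2 * (n : ℝ) * k * l) := by
    refine Real.one_le_exp ?_
    have : 0 ≤ (n : ℝ) * (-k) * l := mul_nonneg (mul_nonneg n.cast_nonneg (neg_nonneg.2 hk)) hl
    linarith
  have h1 : Real.exp (-2 * (n : ℝ) * k * l) * dist x y ^ 2 / (2 * t) ≤ dist (u x) (u y) :=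
    sub_nonpos.1 h
  rw [div_le_iff₀ (by positivity)] at h1
  nlinarith [sq_nonneg (dist x y)]

lemma mem_auxS_iff {Ω' : Set M} (ht : 0 < t) (hK : IsCompact (closure Ω'))
    (hu : ContinuousOn u (closure Ω')) {x y : M} (hx : x ∈ Ω') {l : ℝ} :
    y ∈ auxS n k u Ω' t l x ↔
      y ∈ Ω' ∧ ∀ w ∈ Ω', auxCost n k u t (x, l) y ≤ auxCost n k u t (x, l) w := by
  refine and_congr_right fun hy => ⟨fun h w hw => ?_, fun h => ?_⟩
  · refine le_of_eq_of_le h.symm (csInf_le ⟨-oscOn u (closure Ω'), ?_⟩ ⟨w, hw, rfl⟩)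
    rintro _ ⟨v, hv, rfl⟩
    have h1 := dist_le_oscOn hK hu (subset_closure hx) (subset_closure hv)
    have h2 : 0 ≤ Real.exp (-2 * (n : ℝ) * k * l) * dist x v ^ 2 / (2 * t) := by positivity
    linarith
  · refine IsLeast.csInf_eq ⟨⟨y, hy, rfl⟩, ?_⟩
    rintro _ ⟨w, hw, rfl⟩
    exact h w hw

/-- For `t` below the threshold, points of `closure Ω'` with nonpositive cost are interior. -/
lemma mem_of_auxCost_nonpos {Ω' Ω'' : Set M} (hk : k ≤ 0) (ht : 0 < t) (hΩ'o : IsOpen Ω')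
    (hK : IsCompact (closure Ω')) (hu : ContinuousOn u (closure Ω')) (hsub : Ω'' ⊆ Ω')
    (ht' : t < setDist Ω'' (frontier Ω') ^ 2 / (4 * (2 * oscOn u (closure Ω') + 2)))
    {x y : M} (hx : x ∈ Ω'') (hy : y ∈ closure Ω') {l : ℝ} (hl : 0 ≤ l)
    (h : auxCost n k u t (x, l) y ≤ 0) : y ∈ Ω' := by
  by_contra hyn
  have hfr : y ∈ frontier Ω' := by
    rw [hΩ'o.frontier_eq]
    exact ⟨hy, hyn⟩
  have hosc := dist_le_oscOn hK hu (subset_closure (hsub hx)) hy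
  have hd := dist_sq_le_of_auxCost_nonpos hk ht hl h
  have hle := pow_le_pow_left₀ (setDist_nonneg _ _) (setDist_le_dist hx hfr) 2
  have hnn : 0 ≤ dist (u x) (u y) := dist_nonneg
  rw [lt_div_iff₀ (by linarith)] at ht'
  nlinarith

lemma auxS_nonempty {Ω' Ω'' : Set M} (hk : k ≤ 0) (ht : 0 < t) (hΩ'o : IsOpen Ω')
    (hK : IsCompact (closure Ω')) (hu : ∀ y ∈ closure Ω', ContinuousAt u y) (hsub : Ω'' ⊆ Ω')
    (ht' : t < setDist Ω'' (frontier Ω') ^ 2 / (4 * (2 * oscOn u (closure Ω') + 2)))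
    {x : M} (hx : x ∈ Ω'') {l : ℝ} (hl : 0 ≤ l) : (auxS n k u Ω' t l x).Nonempty := by
  have hxK : x ∈ closure Ω' := subset_closure (hsub hx)
  have hc : ContinuousOn u (closure Ω') := fun y hy => (hu y hy).continuousWithinAt
  have hcost : ContinuousOn (auxCost n k u t (x, l)) (closure Ω') := fun y hy =>
    ContinuousAt.continuousWithinAt
      (tendsto_auxCost tendsto_const_nhds tendsto_id (hu x hxK) (hu y hy))
  obtain ⟨y, hy, hmin⟩ := hK.exists_isMinOn ⟨x, hxK⟩ hcost
  have hle : auxCost n k u t (x, l) y ≤ 0 := (hmin hxK).trans_eq (auxCost_self x l)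
  exact ⟨y, (mem_auxS_iff ht hK hc (hsub hx)).2
    ⟨mem_of_auxCost_nonpos hk ht hΩ'o hK hc hsub ht' hx hy hl hle,
      fun w hw => hmin (subset_closure hw)⟩⟩

/-- The argument of the infimum has closed graph over `Ω'' × [0,1]`, so the distance to it is
lower semicontinuous. -/
lemma lowerSemicontinuousOn_auxL {Ω' Ω'' : Set M} (hk : k ≤ 0) (ht : 0 < t) (hΩ'o : IsOpen Ω')
    (hK : IsCompact (closure Ω')) (hu : ∀ y ∈ closure Ω', ContinuousAt u y) (hsub : Ω'' ⊆ Ω')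
    (ht' : t < setDist Ω'' (frontier Ω') ^ 2 / (4 * (2 * oscOn u (closure Ω') + 2))) :
    LowerSemicontinuousOn (fun z : M × ℝ => auxL n k u Ω' t z.2 z.1)
      (Ω'' ×ˢ Set.Icc (0 : ℝ) 1) := by
  have hc : ContinuousOn u (closure Ω') := fun y hy => (hu y hy).continuousWithinAt
  rintro ⟨x, l⟩ ⟨hx, hl⟩ a ha
  dsimp only at hx hl ha
  obtain ⟨b, hab, hb⟩ := exists_between ha
  by_contra hcon
  rw [not_eventually] at hcon
  have hfreq : ∃ᶠ z : M × ℝ in 𝓝[Ω'' ×ˢ Set.Icc (0 : ℝ) 1] (x, l),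
      ∃ y ∈ auxS n k u Ω' t z.2 z.1, z.1 ∈ Ω'' ∧ dist z.1 y < b := by
    refine (hcon.and_eventually self_mem_nhdsWithin).mono ?_
    rintro ⟨x', l'⟩ ⟨hlt, hx', hl'⟩
    obtain ⟨y, hy, hyb⟩ := (infDist_lt_iff
      (auxS_nonempty hk ht hΩ'o hK hu hsub ht' hx' hl'.1)).1 ((not_lt.1 hlt).trans_lt hab)
    exact ⟨y, hy, hx', hyb⟩
  obtain ⟨𝒰, h𝒰'⟩ := exists_ultrafilter_iff.2 (frequently_iff_neBot.1 hfreq)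
  have h𝒰 : (𝒰 : Filter (M × ℝ)) ≤ 𝓝[Ω'' ×ˢ Set.Icc (0 : ℝ) 1] (x, l) := h𝒰'.trans inf_le_left
  have hev : ∀ᶠ z in (𝒰 : Filter (M × ℝ)),
      ∃ y ∈ auxS n k u Ω' t z.2 z.1, z.1 ∈ Ω'' ∧ dist z.1 y < b :=
    le_principal_iff.1 (h𝒰'.trans inf_le_right)
  obtain ⟨Φ, hev⟩ := hev.choice
  obtain ⟨y, hyK, hy⟩ := hK.ultrafilter_le_nhds (𝒰.map Φ)
    (le_principal_iff.2 (hev.mono fun z hz => subset_closure hz.1.1))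
  have hyt : Tendsto Φ 𝒰 (𝓝 y) := hy
  have hzt : Tendsto id (𝒰 : Filter (M × ℝ)) (𝓝 (x, l)) := h𝒰.trans nhdsWithin_le_nhds
  have hxt : Tendsto Prod.fst (𝒰 : Filter (M × ℝ)) (𝓝 x) := (continuous_fst.tendsto _).comp hzt
  have hxK : x ∈ closure Ω' := subset_closure (hsub hx)
  have hmin : ∀ w ∈ Ω', auxCost n k u t (x, l) y ≤ auxCost n k u t (x, l) w := fun w hw =>
    le_of_tendsto_of_tendsto (tendsto_auxCost hzt hyt (hu x hxK) (hu y hyK))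
      (tendsto_auxCost hzt tendsto_const_nhds (hu x hxK) (hu w (subset_closure hw)))
      (hev.mono fun z hz => ((mem_auxS_iff ht hK hc (hsub hz.2.1)).1 hz.1).2 w hw)
  have hyS : y ∈ auxS n k u Ω' t l x := (mem_auxS_iff ht hK hc (hsub hx)).2
    ⟨mem_of_auxCost_nonpos hk ht hΩ'o hK hc hsub ht' hx hyK hl.1
      ((hmin x (hsub hx)).trans_eq (auxCost_self x l)), hmin⟩
  have hdist : dist x y ≤ b := le_of_tendsto (hxt.dist hyt) (hev.mono fun z hz => hz.2.2.le)
  exact ((infDist_le_dist_of_mem hyS).trans hdist).not_gt hb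

lemma auxL_le_sqrt {Ω' : Set M} (hk : k ≤ 0) (ht : 0 < t)
    (hK : IsCompact (closure Ω')) (hu : ContinuousOn u (closure Ω'))
    {x : M} (hx : x ∈ Ω') {l : ℝ} (hl : 0 ≤ l) :
    auxL n k u Ω' t l x ≤ Real.sqrt ((2 * oscOn u (closure Ω') + 2) * t) := by
  rcases (auxS n k u Ω' t l x).eq_empty_or_nonempty with he | ⟨y, hy⟩
  · simp [auxL, he]
  · refine (infDist_le_dist_of_mem hy).trans (Real.le_sqrt_of_sq_le ?_)
    obtain ⟨hyΩ, hmin⟩ := (mem_auxS_iff ht hK hu hx).1 hy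
    have hd := dist_sq_le_of_auxCost_nonpos hk ht hl ((hmin x hx).trans_eq (auxCost_self x l))
    have hosc := dist_le_oscOn hK hu (subset_closure hx) (subset_closure hyΩ)
    nlinarith

end Auxiliary

/-- Lemma 6.2. For `Ω'' ⊂⊂ Ω'`, `C_* = 2 osc_{cl Ω'} u + 2`,
`t₀ = dist²(Ω'',∂Ω')/(4C_*)` and `t ∈ (0,t₀)`: (i) `(x,λ) ↦ L_{t,λ}(x)` is lower
semi-continuous on `Ω''×[0,1]`; (ii) `‖L_{t,λ}‖_{L^∞(Ω'')} ≤ √(C_* t)` for each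
`λ ∈ [0,1]`. -/
theorem statement_12 (n : ℕ) (k : ℝ) (hk : k ≤ 0)
    {M : Type*} [MetricSpace M] [MeasurableSpace M] [BorelSpace M]
    (hM : AlexandrovSpace M n k)
    {Y : Type*} [MetricSpace Y] (hY : NPCSpace Y)
    (F : SobolevFramework M (μH[(n : ℝ)]))
    (Ω Ω' Ω'' : Set M)
    (hΩo : IsOpen Ω) (hΩc : IsConnected Ω) (hΩb : Bornology.IsBounded Ω)
    (hΩ'o : IsOpen Ω') (hΩ'c : IsConnected Ω') (hΩ' : CptIn Ω' Ω)
    (hΩ''o : IsOpen Ω'') (hΩ''c : IsConnected Ω'') (hΩ'' : CptIn Ω'' Ω')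
    (u : M → Y) (hu : ContinuousOn u Ω) (hharm : IsHarmonicMap F n Ω u)
    (Cstar t₀ : ℝ)
    (hC : Cstar = 2 * oscOn u (closure Ω') + 2)
    (ht₀ : t₀ = setDist Ω'' (frontier Ω') ^ 2 / (4 * Cstar))
    (t : ℝ) (ht : 0 < t) (ht' : t < t₀) :
    LowerSemicontinuousOn (fun z : M × ℝ => auxL n k u Ω' t z.2 z.1)
        (Ω'' ×ˢ Set.Icc (0:ℝ) 1) ∧
      ∀ l ∈ Set.Icc (0:ℝ) 1, ∀ x ∈ Ω'',
        auxL n k u Ω' t l x ≤ Real.sqrt (Cstar * t) := by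
  subst hC ht₀
  have hc : ∀ y ∈ closure Ω', ContinuousAt u y := fun y hy =>
    hu.continuousAt (hΩo.mem_nhds (hΩ'.2 hy))
  have hsub : Ω'' ⊆ Ω' := subset_closure.trans hΩ''.2
  exact ⟨lowerSemicontinuousOn_auxL hk ht hΩ'o hΩ'.1 hc hsub ht', fun l hl x hx =>
    auxL_le_sqrt hk ht hΩ'.1 (hu.mono hΩ'.2) (hsub hx) hl.1⟩

end Paper
end
end

section
/- Let Ω be a bounded domain in an n-dimensional Alexandrov space with curvature ≥ k (k ≤ 0), Y an NPC space, u : Ω → Y a continuous harmonic map, Ω' ⊂⊂ Ω and Ω'' ⊂⊂ Ω'. Let t_* := min{t₀, t₁}, where t₀ := dist²(Ω'',∂Ω')/(4C_*) with C_* := 2·osc_{cl Ω'} u + 2, and t₁ is the constant for which f_t(·,λ) is a super-solution of 𝓛 = −e^{−2nkλ}·(nk/t)·L²_{t,λ}·vol on Ω'' for all t ∈ (0,t₁) and λ ∈ [0,1]. Then for each t ∈ (0,t_*), the function (x,λ) ↦ f_t(x,λ) is a super-solution of the heat equation 𝓛_{f_t} = ∂f_t/∂λ on the cylinder Ω''×(0,1).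 -/
open MeasureTheory Metric Filter Set Asymptotics
open scoped Topology ENNReal NNReal

noncomputable section

namespace Paper

theorem one_add_sq_div_two_le_cosh (x : ℝ) : 1 + x ^ 2 / 2 ≤ Real.cosh x := by
  have h1 : Real.cosh x = 1 + 2 * Real.sinh (x / 2) ^ 2 := by
    have h := Real.cosh_two_mul (x / 2)
    rw [mul_div_cancel₀ x (two_ne_zero), Real.cosh_sq] at h
    linarith
  have h2 : (x / 2) ^ 2 ≤ Real.sinh (x / 2) ^ 2 := by
    rw [sq_le_sq, Real.abs_sinh]
    exact Real.self_le_sinh_iff.2 (abs_nonneg _)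
  rw [h1]
  linarith

theorem cosh_le_one_add_sq {x : ℝ} (hx : |x| ≤ 1) : Real.cosh x ≤ 1 + x ^ 2 := by
  have hx2 : x ^ 2 ≤ 1 := (sq_le_one_iff_abs_le_one x).2 hx
  have h1 := Real.cosh_le_exp_half_sq x
  have h2 := Real.add_one_le_exp (-(x ^ 2 / 2))
  have h3 : Real.exp (x ^ 2 / 2) * Real.exp (-(x ^ 2 / 2)) = 1 := by
    rw [← Real.exp_add]; simp
  have h4 : Real.exp (x ^ 2 / 2) * (-(x ^ 2 / 2) + 1) ≤ 1 :=
    (mul_le_mul_of_nonneg_left h2 (Real.exp_pos _).le).trans_eq h3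
  refine h1.trans (le_of_mul_le_mul_right (h4.trans ?_) (by linarith : 0 < -(x ^ 2 / 2) + 1))
  nlinarith [sq_nonneg x]

theorem sinh_le_two_mul {a : ℝ} (h0 : 0 ≤ a) (h1 : a ≤ 1) : Real.sinh a ≤ 2 * a := by
  have h2 := cosh_le_one_add_sq (x := a) (by rwa [abs_of_nonneg h0])
  have h3 := Real.cosh_sq a
  have h4 := Real.cosh_pos a
  refine abs_le_of_sq_le_sq' ?_ (by linarith) |>.2
  have h5 : Real.cosh a ^ 2 ≤ (1 + a ^ 2) ^ 2 := by gcongr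
  have h6 : a ^ 2 * a ^ 2 ≤ a ^ 2 * 1 := by gcongr; nlinarith
  nlinarith

/-- Hyperbolic comparison of the opposite sides of two hinges whose adjacent sides are in
ratio `e`. -/
theorem mul_le_three_mul_of_cosh_angle_le {e a b c d : ℝ} (he : 0 < e) (he1 : e ≤ 1)
    (ha : 0 < a) (ha1 : a ≤ 1) (hb : 0 < b) (hb1 : b ≤ 1) (hc0 : 0 ≤ c) (hc : c ≤ a + b)
    (hd : |e * a - e * b| ≤ d)
    (h : Real.arccos ((Real.cosh a * Real.cosh b - Real.cosh c) / (Real.sinh a * Real.sinh b)) ≤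
      Real.arccos ((Real.cosh (e * a) * Real.cosh (e * b) - Real.cosh d) /
        (Real.sinh (e * a) * Real.sinh (e * b)))) :
    e * c ≤ 3 * d := by
  have hd0 : 0 ≤ d := (abs_nonneg _).trans hd
  rcases lt_or_ge 1 d with h1d | h1d
  · nlinarith
  have sa := Real.sinh_pos_iff.2 ha
  have sb := Real.sinh_pos_iff.2 hb
  have sea := Real.sinh_pos_iff.2 (mul_pos he ha)
  have seb := Real.sinh_pos_iff.2 (mul_pos he hb)
  have h1 : (Real.cosh (e * a) * Real.cosh (e * b) - Real.cosh d) /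
        (Real.sinh (e * a) * Real.sinh (e * b)) ≤
      (Real.cosh a * Real.cosh b - Real.cosh c) / (Real.sinh a * Real.sinh b) := by
    by_contra! hlt
    refine absurd (Real.arccos_lt_arccos ?_ hlt ?_) (not_lt.2 h)
    · rw [le_div_iff₀ (by positivity)]
      have := (Real.cosh_le_cosh (x := c) (y := a + b)).2
        (by rwa [abs_of_nonneg hc0, abs_of_pos (by positivity)])
      rw [Real.cosh_add] at this
      linarith
    · rw [div_le_iff₀ (by positivity)]
      have := (Real.cosh_le_cosh (x := e * a - e * b) (y := d)).2 (by rwa [abs_of_nonneg hd0])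
      rw [Real.cosh_sub] at this
      linarith
  have e1 := Real.cosh_sub (e * a) (e * b)
  have e2 := Real.cosh_sub a b
  have hab : |a - b| ≤ 1 := by rw [abs_le]; constructor <;> linarith
  have hab2 : (a - b) ^ 2 ≤ 1 := (sq_le_one_iff_abs_le_one _).2 hab
  have h2 := cosh_le_one_add_sq hab
  have h3 := one_add_sq_div_two_le_cosh c
  have h4 := one_add_sq_div_two_le_cosh (e * a - e * b)
  have h5 := cosh_le_one_add_sq (x := d) (by rwa [abs_of_nonneg hd0])
  have h6 : e ^ 2 / 4 * (Real.sinh a * Real.sinh b) ≤ Real.sinh (e * a) * Real.sinh (e * b) := by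
    have i1 := sinh_le_two_mul ha.le ha1
    have i2 := sinh_le_two_mul hb.le hb1
    have i3 := Real.self_le_sinh_iff.2 (mul_pos he ha).le
    have i4 := Real.self_le_sinh_iff.2 (mul_pos he hb).le
    calc e ^ 2 / 4 * (Real.sinh a * Real.sinh b) ≤ e ^ 2 / 4 * ((2 * a) * (2 * b)) := by gcongr
      _ = (e * a) * (e * b) := by ring
      _ ≤ _ := by gcongr
  have h7 : e ^ 2 / 4 * (Real.cosh c - Real.cosh (a - b)) ≤
      Real.cosh d - Real.cosh (e * a - e * b) := by
    rw [div_le_div_iff₀ (by positivity) (by positivity)] at h1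
    rcases le_or_gt (Real.cosh c - Real.cosh (a - b)) 0 with h0 | h0
    · have := (Real.cosh_le_cosh (x := e * a - e * b) (y := d)).2 (by rwa [abs_of_nonneg hd0])
      have := mul_nonpos_of_nonneg_of_nonpos (by positivity : 0 ≤ e ^ 2 / 4) h0
      linarith
    · have h8 : (Real.cosh c - Real.cosh (a - b)) * (Real.sinh (e * a) * Real.sinh (e * b)) ≤
          (Real.cosh d - Real.cosh (e * a - e * b)) * (Real.sinh a * Real.sinh b) := by
        rw [e1, e2]; linarith
      have h9 := mul_le_mul_of_nonneg_left h6 h0.le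
      refine le_of_mul_le_mul_right ?_ (by positivity : 0 < Real.sinh a * Real.sinh b)
      linarith
  have h10 : e ^ 2 * c ^ 2 ≤ 8 * d ^ 2 := by
    have e2pos : 0 < e ^ 2 := by positivity
    have e21 : e ^ 2 ≤ 1 := by nlinarith
    have i1 : e ^ 2 / 4 * (c ^ 2 / 2 - (a - b) ^ 2) ≤
        e ^ 2 / 4 * (Real.cosh c - Real.cosh (a - b)) :=
      mul_le_mul_of_nonneg_left (by linarith) (by positivity)
    have i2 : (e * a - e * b) ^ 2 = e ^ 2 * (a - b) ^ 2 := by ring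
    have i3 : 0 ≤ e ^ 2 * (a - b) ^ 2 := by positivity
    nlinarith
  refine abs_le_of_sq_le_sq' ?_ (by linarith) |>.2
  nlinarith

theorem mul_le_three_mul_of_cmpAngle_le {k e a b c d : ℝ} (hk : k ≤ 0) (he : 0 < e) (he1 : e ≤ 1)
    (ha : 0 < a) (ha1 : √(-k) * a ≤ 1) (hb : 0 < b) (hb1 : √(-k) * b ≤ 1) (hc0 : 0 ≤ c)
    (hc : c ≤ a + b) (hd : |e * a - e * b| ≤ d)
    (h : cmpAngle k a b c ≤ cmpAngle k (e * a) (e * b) d) :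
    e * c ≤ 3 * d := by
  have hd0 : 0 ≤ d := (abs_nonneg _).trans hd
  rcases hk.eq_or_lt with rfl | hk
  · simp only [cmpAngle, if_true] at h
    have h1 : ((e * a) ^ 2 + (e * b) ^ 2 - d ^ 2) / (2 * (e * a) * (e * b)) ≤
        (a ^ 2 + b ^ 2 - c ^ 2) / (2 * a * b) := by
      by_contra! hlt
      refine absurd (Real.arccos_lt_arccos ?_ hlt ?_) (not_lt.2 h)
      · rw [le_div_iff₀ (by positivity)]
        nlinarith
      · rw [div_le_iff₀ (by positivity)]
        have := sq_le_sq' (by linarith [abs_le.1 hd |>.1]) (abs_le.1 hd).2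
        nlinarith
    rw [div_le_div_iff₀ (by positivity) (by positivity)] at h1
    have h2 : (2 * a * b) * (e * c) ^ 2 ≤ (2 * a * b) * d ^ 2 := by nlinarith
    have h3 := le_of_mul_le_mul_left h2 (by positivity)
    have := abs_le_of_sq_le_sq' h3 hd0 |>.2
    linarith
  · have hκ : 0 < √(-k) := Real.sqrt_pos.2 (by linarith)
    simp only [cmpAngle, if_neg hk.ne, if_pos hk] at h
    set κ := √(-k)
    have := mul_le_three_mul_of_cosh_angle_le he he1 (mul_pos hκ ha) ha1 (mul_pos hκ hb) hb1
      (mul_nonneg hκ.le hc0) (c := κ * c) (d := κ * d) (by nlinarith)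
      (by rw [show e * (κ * a) - e * (κ * b) = κ * (e * a - e * b) by ring, abs_mul,
            abs_of_pos hκ]; gcongr)
      (by rwa [mul_left_comm e κ a, mul_left_comm e κ b])
    refine le_of_mul_le_mul_left ?_ hκ
    linarith

/-- Near every point there are maps contracting towards a given center which are bi-Lipschitz from
below with constant comparable to the contraction ratio. -/
theorem CurvBddBelow.exists_homothety {M : Type*} [MetricSpace M] {k : ℝ} (hk : k ≤ 0)
    (hM : CurvBddBelow M k) (q : M) :
    ∃ r > 0, IsCompact (closedBall q r) ∧ ∀ p ∈ closedBall q r, ∀ e : ℝ, 0 < e → e ≤ 1 →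
      ∃ T : M → M, (∀ x ∈ closedBall q r, dist p (T x) ≤ 2 * r * e) ∧
        ∀ x ∈ closedBall q r, ∀ y ∈ closedBall q r, e * dist x y ≤ 3 * dist (T x) (T y) := by
  obtain ⟨U, hU, hcmp⟩ := hM.comparison q
  obtain ⟨r₁, hr₁, hball⟩ := Metric.mem_nhds_iff.1 hU
  have := hM.locallyCompact
  obtain ⟨r₂, hr₂, hcpt⟩ := Metric.exists_isCompact_closedBall q
  set κ := √(-k)
  have hκ : 0 ≤ κ := Real.sqrt_nonneg _
  set r := min (min (r₁ / 4) r₂) (1 / (2 * (κ + 1)))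
  have hr : 0 < r := by positivity
  have hrr₁ : r ≤ r₁ / 4 := (min_le_left _ _).trans (min_le_left _ _)
  have hrr₂ : r ≤ r₂ := (min_le_left _ _).trans (min_le_right _ _)
  have hrκ : κ * (2 * r) ≤ 1 := by
    have h : r ≤ 1 / (2 * (κ + 1)) := min_le_right _ _
    rw [le_div_iff₀ (by positivity)] at h
    nlinarith
  refine ⟨r, hr, hcpt.of_isClosed_subset isClosed_closedBall (closedBall_subset_closedBall hrr₂),
    fun p hp e he he1 => ?_⟩
  choose γ hγ hγ0 hγ1 using hM.geodesic p
  have hpx : ∀ x ∈ closedBall q r, dist p x ≤ 2 * r := fun x hx => by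
    have := dist_triangle_right p x q
    rw [mem_closedBall] at hp hx
    linarith
  have hmem : ∀ x, 0 ≤ e * dist p x ∧ e * dist p x ≤ dist p x := fun x =>
    ⟨by positivity, mul_le_of_le_one_left dist_nonneg he1⟩
  have hγdist : ∀ x, ∀ s ∈ Icc 0 (dist p x), dist p (γ x s) = s := fun x s hs => by
    have h := (hγ x).2 0 ⟨le_rfl, dist_nonneg⟩ s hs
    rwa [hγ0, zero_sub, abs_neg, abs_of_nonneg hs.1] at h
  have hdist : ∀ x, dist p (γ x (e * dist p x)) = e * dist p x := fun x => hγdist x _ (hmem x)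
  have hγU : ∀ x ∈ closedBall q r, ∀ s ∈ Icc 0 (dist p x), γ x s ∈ U := fun x hx s hs => by
    refine hball ?_
    have h1 := hγdist x s hs
    have h2 := dist_triangle_left (γ x s) q p
    have h3 := hpx x hx
    rw [mem_closedBall] at hp
    rw [mem_ball]
    linarith [hs.2]
  refine ⟨fun x => γ x (e * dist p x), fun x hx => ?_, fun x hx y hy => ?_⟩
  · rw [hdist]
    nlinarith [hpx x hx]
  rcases eq_or_ne p x with rfl | hax
  · have h := hdist y
    simp only [dist_self, mul_zero, hγ0]
    rw [h]
    nlinarith [hmem y]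
  rcases eq_or_ne p y with rfl | hay
  · have h := hdist x
    simp only [dist_self, mul_zero, hγ0]
    rw [dist_comm _ p, dist_comm _ p, h]
    nlinarith [hmem x]
  have ha := dist_pos.2 hax
  have hb := dist_pos.2 hay
  have h := hcmp p (γ x) (γ y) _ _ (hγ x) (hγ y) (hγU x hx) (hγU y hy) (hγ0 x) (hγ0 y)
    (e * dist p x) (e * dist p y) (dist p x) (dist p y) (mul_pos he ha) (hmem x).2 le_rfl
    (mul_pos he hb) (hmem y).2 le_rfl
  rw [hγ1, hγ1] at h
  refine mul_le_three_mul_of_cmpAngle_le hk he he1 ha ?_ hb ?_ dist_nonneg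
    (dist_triangle_left _ _ _) ?_ h
  · exact (mul_le_mul_of_nonneg_left (hpx x hx) hκ).trans hrκ
  · exact (mul_le_mul_of_nonneg_left (hpx y hy) hκ).trans hrκ
  · have h1 := abs_dist_sub_le (γ x (e * dist p x)) (γ y (e * dist p y)) p
    rwa [dist_comm _ p, dist_comm _ p, hdist, hdist] at h1

/-- A Cantor set with `N` branches and contraction ratio `θ` forces `N ≤ θ⁻¹ ^ n` in a space of
Hausdorff dimension at most `n`. -/
theorem natCast_le_inv_pow_of_cantor {X : Type*} [MetricSpace X] {N n : ℕ} (hN : 1 < N)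
    {θ c : ℝ} (hθ : 0 < θ) (hθ1 : θ < 1) (hc : 0 < c) (g : (ℕ → Fin N) → X)
    (hg : ∀ w w' m, (∀ j < m, w j = w' j) → w m ≠ w' m → c * θ ^ m ≤ dist (g w) (g w'))
    (hdim : dimH (univ : Set X) ≤ n) : (N : ℝ) ≤ θ⁻¹ ^ n := by
  have hN0 : (0 : ℝ) < N := by positivity
  have hlogN : 0 < Real.log N := Real.log_pos (by exact_mod_cast hN)
  have hlogθ : Real.log θ < 0 := Real.log_neg hθ hθ1
  set s : ℝ := Real.log N / -Real.log θ with hs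
  have hs0 : 0 < s := div_pos hlogN (by linarith)
  have hθs : θ ^ s = (N : ℝ)⁻¹ := by
    rw [Real.rpow_def_of_pos hθ, hs, mul_div_assoc', mul_comm, mul_div_assoc,
      div_neg_self hlogθ.ne, mul_neg_one, Real.exp_neg, Real.exp_log hN0]
  have hsplit : ∀ w w' : ℕ → Fin N, w ≠ w' → ∃ m, (∀ j < m, w j = w' j) ∧ w m ≠ w' m := by
    intro w w' h
    have h' : ∃ m, w m ≠ w' m := Function.ne_iff.1 h
    classical
    exact ⟨Nat.find h', fun j hj => not_not.1 (Nat.find_min h' hj), Nat.find_spec h'⟩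
  have hinj : Function.Injective g := by
    intro w w' h
    by_contra hne
    obtain ⟨m, h1, h2⟩ := hsplit w w' hne
    have := hg w w' m h1 h2
    rw [h, dist_self] at this
    have : 0 < c * θ ^ m := by positivity
    linarith
  have : Nonempty (ℕ → Fin N) := ⟨fun _ => ⟨0, by omega⟩⟩
  set f : X → ℝ := fun x => Real.ofDigits (Function.invFun g x)
  have hfg : ∀ w, f (g w) = Real.ofDigits w := fun w => by
    simp only [f, Function.leftInverse_invFun hinj w]
  have hdist : ∀ w w', dist (f (g w)) (f (g w')) ≤ c⁻¹ ^ s * dist (g w) (g w') ^ s := by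
    intro w w'
    rcases eq_or_ne w w' with rfl | hne
    · simp only [dist_self]
      positivity
    obtain ⟨m, h1, h2⟩ := hsplit w w' hne
    rw [hfg, hfg, Real.dist_eq]
    refine (Real.abs_ofDigits_sub_ofDigits_le h1).trans ?_
    calc ((N : ℝ) ^ m)⁻¹ = (θ ^ m) ^ s := by
          rw [← Real.rpow_natCast θ m, ← Real.rpow_mul hθ.le, mul_comm, Real.rpow_mul hθ.le, hθs,
            Real.rpow_natCast, inv_pow]
      _ ≤ (c⁻¹ * dist (g w) (g w')) ^ s := by
          gcongr
          rw [inv_mul_eq_div, le_div_iff₀ hc, mul_comm]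
          exact hg w w' m h1 h2
      _ = _ := Real.mul_rpow (by positivity) dist_nonneg
  have hhol : HolderOnWith (Real.toNNReal (c⁻¹ ^ s)) (Real.toNNReal s) f (range g) := by
    rintro _ ⟨w, rfl⟩ _ ⟨w', rfl⟩
    rw [edist_dist, edist_dist, Real.coe_toNNReal _ hs0.le,
      ENNReal.ofReal_rpow_of_nonneg dist_nonneg hs0.le]
    change _ ≤ ENNReal.ofReal (c⁻¹ ^ s) * _
    rw [← ENNReal.ofReal_mul (by positivity)]
    exact ENNReal.ofReal_le_ofReal (hdist w w')
  have h1 := hhol.dimH_image_le (Real.toNNReal_pos.2 hs0)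
  have hsub : Icc (0 : ℝ) 1 ⊆ f '' range g := by
    intro y hy
    obtain ⟨w, -, hw⟩ := Real.ofDigits_SurjOn hN hy
    exact ⟨g w, ⟨w, rfl⟩, (hfg w).trans hw⟩
  have h2 : dimH (Icc (0 : ℝ) 1) = 1 := by
    have := Real.dimH_of_nonempty_interior (E := ℝ) (s := Icc (0 : ℝ) 1) (by simp)
    simpa using this
  have h3 : (1 : ℝ≥0∞) ≤ n / (Real.toNNReal s : ℝ≥0∞) :=
    h2.symm.le.trans <| (dimH_mono hsub).trans <| h1.trans <|
      ENNReal.div_le_div_right ((dimH_mono (subset_univ _)).trans hdim) _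
  have h4 : s ≤ n := by
    rw [ENNReal.le_div_iff_mul_le (Or.inl (by simpa using hs0)) (Or.inl (by simp)), one_mul] at h3
    have h5 : Real.toNNReal s ≤ (n : ℝ≥0) := by exact_mod_cast h3
    simpa using Real.toNNReal_le_iff_le_coe.1 h5
  rw [hs, div_le_iff₀ (by linarith)] at h4
  rw [← Real.log_le_log_iff hN0 (by positivity), Real.log_pow, Real.log_inv]
  exact h4

/-- Packing bound in a ball carrying homotheties of every ratio, in a space of Hausdorff
dimension at most `n`. -/
theorem natCast_le_of_separated {X : Type*} [MetricSpace X] {n : ℕ}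
    (hdim : dimH (univ : Set X) ≤ n) {q : X} {r : ℝ} (hr : 0 < r)
    (hcpt : IsCompact (closedBall q r))
    (hT : ∀ p ∈ closedBall q r, ∀ e : ℝ, 0 < e → e ≤ 1 →
      ∃ T : X → X, (∀ x ∈ closedBall q r, dist p (T x) ≤ 2 * r * e) ∧
        ∀ x ∈ closedBall q r, ∀ y ∈ closedBall q r, e * dist x y ≤ 3 * dist (T x) (T y))
    {δ : ℝ} (hδ : 0 < δ) (hδr : δ ≤ r) {N : ℕ} (p : Fin N → X) (hp : ∀ i, p i ∈ closedBall q r)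
    (hsep : Pairwise fun i j => δ ≤ dist (p i) (p j)) : (N : ℝ) ≤ (48 * r / δ) ^ n := by
  rcases le_or_gt N 1 with hN | hN
  · refine (by exact_mod_cast hN : (N : ℝ) ≤ 1).trans (one_le_pow₀ ?_)
    rw [le_div_iff₀ hδ]
    linarith
  choose! T hT1 hT2 using hT
  set θ : ℝ := δ / (48 * r) with hθdef
  have hθ : 0 < θ := by positivity
  have hθ48 : θ ≤ 1 / 48 := by
    rw [hθdef, div_le_div_iff₀ (by positivity) (by positivity)]
    linarith
  have hθr : 48 * (r * θ) = δ := by rw [hθdef]; field_simp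
  have hpow : ∀ m, 0 < θ ^ m ∧ θ ^ m ≤ 1 := fun m =>
    ⟨by positivity, pow_le_one₀ hθ.le (by linarith)⟩
  let x : (ℕ → Fin N) → ℕ → X := fun w m =>
    Nat.rec q (fun m z => T z (θ ^ (m + 1)) (p (w m))) m
  have hx0 : ∀ w, x w 0 = q := fun _ => rfl
  have hxs : ∀ w m, x w (m + 1) = T (x w m) (θ ^ (m + 1)) (p (w m)) := fun _ _ => rfl
  have hmem' : ∀ w m, dist (x w m) q ≤ r * (1 - θ ^ m) := by
    intro w m
    induction m with
    | zero => simp [hx0]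
    | succ m ih =>
      have hin : x w m ∈ closedBall q r := by
        rw [mem_closedBall]
        nlinarith [hpow m]
      have h1 := hT1 _ hin _ (hpow (m + 1)).1 (hpow (m + 1)).2 _ (hp (w m))
      rw [← hxs] at h1
      have h2 := dist_triangle_left (x w (m + 1)) q (x w m)
      have h3 : r * θ ^ (m + 1) ≤ r * θ ^ m / 48 := by
        rw [pow_succ]
        have : 0 < r * θ ^ m := by positivity
        nlinarith
      have h4 : 0 < r * θ ^ m := by positivity
      nlinarith
  have hmem : ∀ w m, x w m ∈ closedBall q r := fun w m => by
    rw [mem_closedBall]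
    nlinarith [hpow m, hmem' w m]
  have hstep : ∀ w m, dist (x w m) (x w (m + 1)) ≤ 2 * r * θ * θ ^ m := fun w m => by
    rw [hxs]
    refine (hT1 _ (hmem w m) _ (hpow (m + 1)).1 (hpow (m + 1)).2 _ (hp (w m))).trans_eq ?_
    ring
  have hlim : ∀ w, ∃ z, Tendsto (x w) atTop (𝓝 z) := fun w => by
    obtain ⟨z, -, hz⟩ := cauchySeq_tendsto_of_isComplete hcpt.isComplete (hmem w)
      (cauchySeq_of_le_geometric θ _ (by linarith) (hstep w))
    exact ⟨z, hz⟩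
  choose g hg using hlim
  have htail : ∀ w m, dist (x w m) (g w) ≤ δ / 16 * θ ^ m := fun w m => by
    refine (dist_le_of_le_geometric_of_tendsto θ _ (by linarith) (hstep w) (hg w) m).trans ?_
    rw [div_le_iff₀ (by linarith), ← hθr]
    have : 0 < r * θ * θ ^ m := by positivity
    nlinarith
  have hcongr : ∀ w w' m, (∀ j < m, w j = w' j) → x w m = x w' m := by
    intro w w' m
    induction m with
    | zero => intro _; rfl
    | succ m ih =>
      intro h
      rw [hxs, hxs, ih fun j hj => h j (by omega), h m (by omega)]
  have key := natCast_le_inv_pow_of_cantor (n := n) hN hθ (by linarith)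
    (c := θ * δ / 6) (by positivity) g ?_ hdim
  · rwa [hθdef, inv_div] at key
  intro w w' m h1 h2
  have h3 := hT2 _ (hmem w m) _ (hpow (m + 1)).1 (hpow (m + 1)).2 _ (hp (w m)) _ (hp (w' m))
  have h4 := hxs w' m
  rw [← hcongr w w' m h1] at h4
  rw [← hxs, ← h4] at h3
  have h5 : θ ^ (m + 1) * δ ≤ θ ^ (m + 1) * dist (p (w m)) (p (w' m)) :=
    mul_le_mul_of_nonneg_left (hsep h2) (hpow _).1.le
  have h6 := htail w (m + 1)
  have h7 := htail w' (m + 1)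
  have h8 := dist_triangle4_right (x w (m + 1)) (x w' (m + 1)) (g w) (g w')
  have h9 : 0 < θ ^ (m + 1) * δ := by positivity
  have h10 : θ * δ / 6 * θ ^ m = θ ^ (m + 1) * δ / 6 := by ring
  rw [h10]
  linarith

/-- Uniform packing bounds make the `n`-dimensional Hausdorff measure finite. -/
theorem hausdorffMeasure_lt_top_of_separated {X : Type*} [MetricSpace X] [MeasurableSpace X]
    [BorelSpace X] {n : ℕ} {A : Set X} {r C : ℝ} (hr : 0 < r)
    (h : ∀ δ : ℝ, 0 < δ → δ ≤ r → ∀ (N : ℕ) (p : Fin N → X), (∀ i, p i ∈ A) →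
      (Pairwise fun i j => δ ≤ dist (p i) (p j)) → (N : ℝ) ≤ (C / δ) ^ n) :
    μH[(n : ℝ)] A < ∞ := by
  have hex : ∀ δ : ℝ, 0 < δ → δ ≤ r → ∃ s : Finset X, (s.card : ℝ) ≤ (C / δ) ^ n ∧
      A ⊆ ⋃ i : s, closedBall (i : X) δ := by
    intro δ hδ hδr
    classical
    let P : ℕ → Prop := fun m => ∃ s : Finset X, (∀ x ∈ s, x ∈ A) ∧
      (∀ x ∈ s, ∀ y ∈ s, x ≠ y → δ ≤ dist x y) ∧ s.card = m
    have hP : ∀ m, P m → (m : ℝ) ≤ (C / δ) ^ n := by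
      rintro m ⟨s, hsA, hs, rfl⟩
      refine h δ hδ hδr s.card (fun i => s.equivFin.symm i) (fun i => hsA _ (Subtype.prop _)) ?_
      intro i j hij
      exact hs _ (Subtype.prop _) _ (Subtype.prop _)
        fun h' => hij (s.equivFin.symm.injective (Subtype.ext h'))
    have hPB : ∀ m, P m → m ≤ ⌊(C / δ) ^ n⌋₊ := fun m hm => Nat.le_floor (hP m hm)
    have h0 : P 0 := ⟨∅, by simp⟩
    obtain ⟨s, hsA, hs, hcard⟩ := Nat.findGreatest_spec (P := P) (Nat.zero_le _) h0
    refine ⟨s, hP _ ⟨s, hsA, hs, rfl⟩, fun x hx => ?_⟩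
    by_contra hcon
    simp only [mem_iUnion, mem_closedBall, not_exists, not_le, Subtype.forall] at hcon
    have hxs : x ∉ s := fun hxs => by
      have := hcon x hxs
      rw [dist_self] at this
      linarith
    have hPs : P (s.card + 1) := by
      refine ⟨insert x s, ?_, ?_, Finset.card_insert_of_notMem hxs⟩
      · simpa using ⟨hx, hsA⟩
      · intro y hy z hz hyz
        rcases Finset.mem_insert.1 hy with hyx | hys <;>
          rcases Finset.mem_insert.1 hz with hzx | hzs
        · exact absurd (hyx.trans hzx.symm) hyz
        · exact hyx ▸ (hcon z hzs).le
        · exact dist_comm y z ▸ hzx ▸ (hcon y hys).le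
        · exact hs y hys z hzs hyz
    exact Nat.not_succ_le_self _ ((Nat.le_findGreatest (hPB _ hPs) hPs).trans hcard.ge)
  have hδ : ∀ j : ℕ, 0 < r / (j + 1) ∧ r / (j + 1) ≤ r := fun j =>
    ⟨by positivity, div_le_self hr.le (by linarith [(Nat.cast_nonneg j : (0 : ℝ) ≤ j)])⟩
  choose s hs hcov using fun j : ℕ => hex _ (hδ j).1 (hδ j).2
  have hdiam : ∀ (j : ℕ) (i : s j),
      ediam (closedBall (i : X) (r / (j + 1))) ≤ ENNReal.ofReal (2 * (r / (j + 1))) := by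
    intro j i
    refine ediam_le fun x hx y hy => ?_
    rw [edist_dist]
    refine ENNReal.ofReal_le_ofReal ?_
    rw [mem_closedBall] at hx hy
    linarith [dist_triangle_right x y i]
  have key := Measure.hausdorffMeasure_le_liminf_sum (l := atTop) (ι := fun j : ℕ => s j) (n : ℝ) A
    (fun j : ℕ => ENNReal.ofReal (2 * (r / (j + 1)))) ?_
    (fun j i => closedBall (i : X) (r / (j + 1))) (.of_forall hdiam) (.of_forall hcov)
  · refine key.trans_lt (lt_of_le_of_lt ?_ (ENNReal.ofReal_lt_top (r := (2 * C) ^ n)))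
    refine (liminf_le_liminf (.of_forall fun j => ?_)).trans_eq (liminf_const _)
    calc ∑ i : s j, ediam (closedBall (i : X) (r / (j + 1))) ^ (n : ℝ)
        ≤ ∑ _i : s j, ENNReal.ofReal (2 * (r / (j + 1))) ^ (n : ℝ) := by
          gcongr with i
          exact hdiam j i
      _ = ENNReal.ofReal ((s j).card * (2 * (r / (j + 1))) ^ n) := by
          have := (hδ j).1
          rw [ENNReal.ofReal_mul (p := ((s j).card : ℝ)) (by positivity), ENNReal.ofReal_natCast,
            ENNReal.ofReal_pow (by positivity)]
          simp
      _ ≤ ENNReal.ofReal ((2 * C) ^ n) := by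
          refine ENNReal.ofReal_le_ofReal ?_
          have h1 := (hδ j).1
          calc ((s j).card : ℝ) * (2 * (r / (j + 1))) ^ n
              ≤ (C / (r / (j + 1))) ^ n * (2 * (r / (j + 1))) ^ n := by
                gcongr
                exact hs j
            _ = (2 * C) ^ n := by
                rw [← mul_pow]
                congr 1
                field_simp
  · rw [← ENNReal.ofReal_zero]
    refine ENNReal.tendsto_ofReal ?_
    have := (tendsto_const_div_atTop_nhds_zero_nat r).comp (tendsto_add_atTop_nat 1)
    have h2 := this.const_mul 2
    rw [mul_zero] at h2
    refine h2.congr fun j => ?_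
    simp

theorem AlexandrovSpace.isLocallyFiniteMeasure {M : Type*} [MetricSpace M] [MeasurableSpace M]
    [BorelSpace M] {n : ℕ} {k : ℝ} (hk : k ≤ 0) (hM : AlexandrovSpace M n k) :
    IsLocallyFiniteMeasure (μH[(n : ℝ)] : Measure M) := by
  refine ⟨fun q => ?_⟩
  obtain ⟨r, hr, hcpt, hT⟩ := hM.curv.exists_homothety hk q
  exact ⟨closedBall q r, closedBall_mem_nhds q hr, hausdorffMeasure_lt_top_of_separated hr
    fun δ hδ hδr N p hp hsep => natCast_le_of_separated hM.dim.le hr hcpt hT hδ hδr p hp hsep⟩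

section AuxF

variable {n : ℕ} {k : ℝ} {M : Type*} [MetricSpace M] {Y : Type*} [MetricSpace Y] {u : M → Y}
  {Ω' : Set M} {t R D : ℝ} {x x' y : M} {l l' : ℝ}

theorem auxF_le (ht : 0 < t) (hR : ∀ x ∈ Ω', ∀ y ∈ Ω', dist (u x) (u y) ≤ R)
    (hx : x ∈ Ω') (hy : y ∈ Ω') :
    auxF n k u Ω' t x l ≤
      Real.exp (-2 * (n : ℝ) * k * l) * dist x y ^ 2 / (2 * t) - dist (u x) (u y) := by
  refine csInf_le ⟨-R, ?_⟩ ⟨y, hy, rfl⟩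
  rintro v ⟨z, hz, rfl⟩
  have : 0 ≤ Real.exp (-2 * (n : ℝ) * k * l) * dist x z ^ 2 / (2 * t) := by positivity
  linarith [hR x hx z hz]

theorem le_auxF {c : ℝ} (hne : Ω'.Nonempty)
    (h : ∀ y ∈ Ω', c ≤
      Real.exp (-2 * (n : ℝ) * k * l) * dist x y ^ 2 / (2 * t) - dist (u x) (u y)) :
    c ≤ auxF n k u Ω' t x l := by
  obtain ⟨y, hy⟩ := hne
  refine le_csInf ⟨_, y, hy, rfl⟩ ?_
  rintro v ⟨z, hz, rfl⟩
  exact h z hz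

theorem monotone_auxF (hk : k ≤ 0) (ht : 0 < t)
    (hR : ∀ x ∈ Ω', ∀ y ∈ Ω', dist (u x) (u y) ≤ R) (hx : x ∈ Ω') :
    Monotone fun l => auxF n k u Ω' t x l := by
  intro l l' hl
  refine le_auxF ⟨x, hx⟩ fun y hy => (auxF_le ht hR hx hy).trans ?_
  have : -2 * (n : ℝ) * k * l ≤ -2 * (n : ℝ) * k * l' :=
    mul_le_mul_of_nonneg_left hl (by nlinarith [n.cast_nonneg (α := ℝ)])
  gcongr

theorem monotone_sub_auxF (hk : k ≤ 0) (ht : 0 < t)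
    (hR : ∀ x ∈ Ω', ∀ y ∈ Ω', dist (u x) (u y) ≤ R)
    (hD : ∀ x ∈ Ω', ∀ y ∈ Ω', dist x y ≤ D) (hx : x ∈ Ω') :
    Monotone fun l => Real.exp (-2 * (n : ℝ) * k * l) * D ^ 2 / (2 * t)
      - auxF n k u Ω' t x l := by
  intro l l' hl
  have he : Real.exp (-2 * (n : ℝ) * k * l) ≤ Real.exp (-2 * (n : ℝ) * k * l') :=
    Real.exp_le_exp.2
      (mul_le_mul_of_nonneg_left hl (by nlinarith [n.cast_nonneg (α := ℝ)]))
  have : auxF n k u Ω' t x l' - (Real.exp (-2 * (n : ℝ) * k * l')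
      - Real.exp (-2 * (n : ℝ) * k * l)) * D ^ 2 / (2 * t) ≤ auxF n k u Ω' t x l := by
    refine le_auxF ⟨x, hx⟩ fun y hy => ?_
    have h1 := auxF_le (n := n) (k := k) (l := l') ht hR hx hy
    have h2 : (Real.exp (-2 * (n : ℝ) * k * l') - Real.exp (-2 * (n : ℝ) * k * l))
        * dist x y ^ 2 / (2 * t) ≤ (Real.exp (-2 * (n : ℝ) * k * l')
        - Real.exp (-2 * (n : ℝ) * k * l)) * D ^ 2 / (2 * t) := by
      have := hD x hx y hy
      have := sub_nonneg.2 he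
      gcongr
    rw [sub_mul, sub_div] at h2
    linarith
  rw [sub_mul, sub_div] at this
  dsimp only
  linarith

theorem hasDerivAt_exp_mul_div (c a b l : ℝ) :
    HasDerivAt (fun l => Real.exp (c * l) * a / b) (Real.exp (c * l) * c * a / b) l := by
  have h : HasDerivAt (fun l => c * l) c l := by
    simpa using (hasDerivAt_id l).const_mul c
  exact (h.exp.mul_const a).div_const b

theorem deriv_auxF_nonneg (hk : k ≤ 0) (ht : 0 < t)
    (hR : ∀ x ∈ Ω', ∀ y ∈ Ω', dist (u x) (u y) ≤ R) (hx : x ∈ Ω') (l : ℝ) :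
    0 ≤ deriv (fun s => auxF n k u Ω' t x s) l :=
  (monotone_auxF hk ht hR hx).deriv_nonneg

theorem deriv_auxF_le (hk : k ≤ 0) (ht : 0 < t)
    (hR : ∀ x ∈ Ω', ∀ y ∈ Ω', dist (u x) (u y) ≤ R)
    (hD : ∀ x ∈ Ω', ∀ y ∈ Ω', dist x y ≤ D) (hx : x ∈ Ω') (l : ℝ) :
    deriv (fun s => auxF n k u Ω' t x s) l ≤
      Real.exp (-2 * (n : ℝ) * k * l) * (-2 * (n : ℝ) * k) * D ^ 2 / (2 * t) := by
  have hE := hasDerivAt_exp_mul_div (-2 * (n : ℝ) * k) (D ^ 2) (2 * t) l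
  by_cases hd : DifferentiableAt ℝ (fun s => auxF n k u Ω' t x s) l
  · have h := (monotone_sub_auxF (n := n) hk ht hR hD hx).deriv_nonneg (x := l)
    rw [(hE.fun_sub hd.hasDerivAt).deriv] at h
    linarith
  · rw [deriv_zero_of_not_differentiableAt hd]
    have : 0 ≤ -2 * (n : ℝ) * k := by nlinarith [n.cast_nonneg (α := ℝ)]
    positivity

theorem auxL_sq_le_deriv_auxF (hk : k ≤ 0) (ht : 0 < t)
    (hR : ∀ x ∈ Ω', ∀ y ∈ Ω', dist (u x) (u y) ≤ R) (hx : x ∈ Ω')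
    (hd : DifferentiableAt ℝ (fun s => auxF n k u Ω' t x s) l) :
    -(Real.exp (-2 * (n : ℝ) * k * l) * ((n : ℝ) * k / t) * auxL n k u Ω' t l x ^ 2) ≤
      deriv (fun s => auxF n k u Ω' t x s) l := by
  rcases (auxS n k u Ω' t l x).eq_empty_or_nonempty with hS | ⟨y, hy⟩
  · simpa [auxL, hS] using deriv_auxF_nonneg hk ht hR hx l
  · have hE := hasDerivAt_exp_mul_div (-2 * (n : ℝ) * k) (dist x y ^ 2) (2 * t) l
    have hmin : IsLocalMin (fun s => Real.exp (-2 * (n : ℝ) * k * s) * dist x y ^ 2 / (2 * t)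
        - dist (u x) (u y) - auxF n k u Ω' t x s) l := by
      refine Eventually.of_forall fun s => ?_
      have h1 := auxF_le (n := n) (k := k) (l := s) ht hR hx hy.1
      have h2 := hy.2
      dsimp only
      linarith
    have h0 := hmin.deriv_eq_zero
    rw [((hE.sub_const _).fun_sub hd.hasDerivAt).deriv] at h0
    have hL : auxL n k u Ω' t l x ^ 2 ≤ dist x y ^ 2 :=
      pow_le_pow_left₀ infDist_nonneg (infDist_le_dist_of_mem hy) 2
    have hc : 0 ≤ Real.exp (-2 * (n : ℝ) * k * l) * (-(n * k) / t) := by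
      have : 0 ≤ -((n : ℝ) * k) := by nlinarith [n.cast_nonneg (α := ℝ)]
      positivity
    have := mul_le_mul_of_nonneg_left hL hc
    have e1 : Real.exp (-2 * (n : ℝ) * k * l) * (-2 * (n : ℝ) * k) * dist x y ^ 2 / (2 * t)
        = Real.exp (-2 * (n : ℝ) * k * l) * (-(n * k) / t) * dist x y ^ 2 := by
      field_simp
    rw [e1] at h0
    have e2 : -(Real.exp (-2 * (n : ℝ) * k * l) * ((n : ℝ) * k / t)
        * auxL n k u Ω' t l x ^ 2) = Real.exp (-2 * (n : ℝ) * k * l) * (-(n * k) / t)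
        * auxL n k u Ω' t l x ^ 2 := by ring
    linarith

theorem auxF_le_add (ht : 0 < t) (hR : ∀ x ∈ Ω', ∀ y ∈ Ω', dist (u x) (u y) ≤ R)
    (hD : ∀ x ∈ Ω', ∀ y ∈ Ω', dist x y ≤ D) (hx : x ∈ Ω') (hx' : x' ∈ Ω') :
    auxF n k u Ω' t x' l' ≤ auxF n k u Ω' t x l +
      (|Real.exp (-2 * (n : ℝ) * k * l') - Real.exp (-2 * (n : ℝ) * k * l)| * D ^ 2 / (2 * t)
        + Real.exp (-2 * (n : ℝ) * k * l) * (2 * D * dist x x') / (2 * t)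
        + dist (u x) (u x')) := by
  rw [← sub_le_iff_le_add]
  refine le_auxF ⟨x, hx⟩ fun y hy => ?_
  have h1 := auxF_le (n := n) (k := k) (l := l') ht hR hx' hy
  set e := Real.exp (-2 * (n : ℝ) * k * l)
  set e' := Real.exp (-2 * (n : ℝ) * k * l')
  have he : 0 ≤ e := (Real.exp_pos _).le
  have h2 : (e' - e) * dist x' y ^ 2 / (2 * t) ≤ |e' - e| * D ^ 2 / (2 * t) := by
    have := hD x' hx' y hy
    gcongr
    exact le_abs_self _
  have h3 : dist x' y ^ 2 - dist x y ^ 2 ≤ 2 * D * dist x x' := by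
    have a := dist_triangle x' x y
    rw [dist_comm x' x] at a
    have b := hD x' hx' y hy
    have c := hD x hx y hy
    nlinarith [dist_nonneg (x := x) (y := x'), dist_nonneg (x := x) (y := y),
      dist_nonneg (x := x') (y := y)]
  have h4 : e * (dist x' y ^ 2 - dist x y ^ 2) / (2 * t) ≤ e * (2 * D * dist x x') / (2 * t) := by
    gcongr
  have h5 := dist_triangle (u x) (u x') (u y)
  have e1 : e' * dist x' y ^ 2 / (2 * t) = e * dist x y ^ 2 / (2 * t)
      + (e' - e) * dist x' y ^ 2 / (2 * t)
      + e * (dist x' y ^ 2 - dist x y ^ 2) / (2 * t) := by ring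
  linarith

theorem continuous_auxF (ht : 0 < t) (hR : ∀ x ∈ Ω', ∀ y ∈ Ω', dist (u x) (u y) ≤ R)
    (hD : ∀ x ∈ Ω', ∀ y ∈ Ω', dist x y ≤ D) {A : Set M} (hA : A ⊆ Ω') (hu : ContinuousOn u A) :
    Continuous (Function.uncurry fun (x : A) (l : ℝ) => auxF n k u Ω' t x l) := by
  rw [continuous_iff_continuousAt]
  rintro ⟨x, l⟩
  rw [ContinuousAt, tendsto_iff_dist_tendsto_zero]
  have hu' : Continuous fun p : A × ℝ => u p.1 := hu.domRestrict.comp continuous_fst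
  set b : A × ℝ → ℝ := fun p =>
    |Real.exp (-2 * (n : ℝ) * k * p.2) - Real.exp (-2 * (n : ℝ) * k * l)| * D ^ 2 / (2 * t)
      + (Real.exp (-2 * (n : ℝ) * k * l) + Real.exp (-2 * (n : ℝ) * k * p.2))
        * (2 * D * dist (x : M) p.1) / (2 * t) + dist (u x) (u p.1) with hb
  have he : Continuous fun p : A × ℝ => Real.exp (-2 * (n : ℝ) * k * p.2) := by fun_prop
  have hd : Continuous fun p : A × ℝ => dist (x : M) p.1 := by fun_prop
  have hbc : Continuous b :=
    (((((he.sub continuous_const).abs).mul_const _).div_const _).add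
      (((continuous_const.add he).mul (hd.const_mul _)).div_const _)).add
      (continuous_const.dist hu')
  have hb0 : b (x, l) = 0 := by simp [hb]
  refine squeeze_zero (fun _ => dist_nonneg) (g := b) ?_ (hb0 ▸ hbc.tendsto (x, l))
  rintro ⟨y, s⟩
  have hx := hA x.2
  have hy := hA y.2
  have h1 := auxF_le_add (n := n) (k := k) (l := l) (l' := s) ht hR hD hx hy
  have h2 := auxF_le_add (n := n) (k := k) (l := s) (l' := l) ht hR hD hy hx
  rw [dist_comm (y : M), dist_comm (u y), abs_sub_comm] at h2
  have hD0 : 0 ≤ D := dist_nonneg.trans (hD x hx y hy)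
  have p1 : 0 ≤ Real.exp (-2 * (n : ℝ) * k * l) * (2 * D * dist (x : M) y) / (2 * t) := by
    positivity
  have p2 : 0 ≤ Real.exp (-2 * (n : ℝ) * k * s) * (2 * D * dist (x : M) y) / (2 * t) := by
    positivity
  simp only [Function.uncurry_apply_pair, hb, Real.dist_eq, add_mul, add_div]
  rw [abs_le]
  constructor <;> linarith

end AuxF

theorem restrict_prod_eq {α β : Type*} [MeasurableSpace α] [MeasurableSpace β] (μ : Measure α)
    (ν : Measure β) [SFinite ν] {A : Set α} {B : Set β} (hA : MeasurableSet A)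
    (hB : MeasurableSet B) :
    (μ.prod ν).restrict (A ×ˢ B) = (μ.restrict A).prod (ν.restrict B) := by
  ext S hS
  rw [Measure.restrict_apply hS, Measure.prod_apply (hS.inter (hA.prod hB)),
    Measure.prod_apply hS, ← lintegral_indicator hA]
  refine lintegral_congr fun x => ?_
  by_cases hx : x ∈ A
  · rw [indicator_of_mem hx, Measure.restrict_apply (measurable_prodMk_left hS)]
    congr 1
    ext y
    simp [hx]
  · have : Prod.mk x ⁻¹' (S ∩ A ×ˢ B) = ∅ := by
      ext y
      simp [hx]
    rw [indicator_of_notMem hx, this, measure_empty]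

theorem IsLip0.slice {M : Type*} [MetricSpace M] {G : Set M} {I : Set ℝ} {φ : M × ℝ → ℝ}
    (h : IsLip0 (G ×ˢ I) φ) (l : ℝ) : IsLip0 G fun x => φ (x, l) := by
  obtain ⟨⟨c, hc⟩, hcpt, hsub⟩ := h
  have hl : Continuous fun x : M => (x, l) := by fun_prop
  have hts : tsupport (fun x => φ (x, l)) ⊆ (fun x => (x, l)) ⁻¹' tsupport φ :=
    tsupport_comp_subset_preimage φ hl
  refine ⟨⟨c * 1, hc.comp (LipschitzWith.prodMk_right l)⟩, ?_, fun x hx => (hsub (hts hx)).1⟩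
  exact (hcpt.image continuous_fst).of_isClosed_subset (isClosed_tsupport _)
    fun x hx => ⟨_, hts hx, rfl⟩

/-- If `f` is separately monotone in time with bounded time derivative and jointly continuous, a
slicewise super-solution of a Poisson equation whose right-hand side is dominated by the time
derivative is a super-solution of the heat equation. -/
theorem isHeatSupersolution_of_slices {M : Type*} [MetricSpace M] [MeasurableSpace M]
    [BorelSpace M] {μ : Measure M} (F : SobolevFramework M μ) {G : Set M} (hG : IsOpen G)
    (hμG : μ G < ∞) {f h : M → ℝ → ℝ} {C : ℝ}
    (hcont : Continuous (Function.uncurry fun (x : G) (l : ℝ) => f x l))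
    (hmono : ∀ x ∈ G, Monotone (f x))
    (hC : ∀ x ∈ G, ∀ l ∈ Ioo (0 : ℝ) 1, deriv (f x) l ≤ C)
    (hh : ∀ x ∈ G, ∀ l, 0 ≤ h x l)
    (hle : ∀ x ∈ G, ∀ l, DifferentiableAt ℝ (f x) l → h x l ≤ deriv (f x) l)
    (hsup : ∀ l ∈ Ioo (0 : ℝ) 1, IsSupersolution F G (fun x => f x l) fun x => h x l) :
    IsHeatSupersolution F G (Ioo (0 : ℝ) 1) fun z => f z.1 z.2 := by
  intro φ hφ hφ0
  have hφs := hφ.slice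
  obtain ⟨⟨c, hc⟩, hcpt, -⟩ := hφ
  obtain ⟨K, hK⟩ := HasCompactSupport.exists_bound_of_continuous hcpt hc.continuous
  have hGm := hG.measurableSet
  have : IsFiniteMeasure (μ.restrict G) := ⟨by simpa using hμG⟩
  have hQ : MeasurableSet (G ×ˢ Ioo (0 : ℝ) 1) := hGm.prod measurableSet_Ioo
  have hemb : MeasurableEmbedding (Prod.map ((↑) : G → M) (id : ℝ → ℝ)) :=
    (MeasurableEmbedding.subtype_coe hGm).prodMap MeasurableEmbedding.id
  obtain ⟨d, hdm, hd⟩ := hemb.exists_measurable_extend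
    (measurable_deriv_with_param hcont) fun _ => ⟨0⟩
  have hdeq : ∀ x ∈ G, ∀ l, d (x, l) = deriv (f x) l := fun x hx l =>
    congrFun hd (⟨x, hx⟩, l)
  have hB := hemb.measurableSet_image.2 (measurableSet_of_differentiableAt_with_param ℝ hcont).compl
  set B := Prod.map ((↑) : G → M) (id : ℝ → ℝ) ''
    {p : G × ℝ | DifferentiableAt ℝ (f p.1) p.2}ᶜ
  have hBmem : ∀ x ∈ G, ∀ l, (x, l) ∉ B → DifferentiableAt ℝ (f x) l := by
    intro x hx l hl
    by_contra hnd
    exact hl ⟨(⟨x, hx⟩, l), hnd, rfl⟩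
  have hae : ∀ᵐ l ∂(volume.restrict (Ioo (0 : ℝ) 1)), ∀ᵐ x ∂(μ.restrict G), (x, l) ∉ B := by
    rw [← Measure.ae_ae_comm (p := fun x l => (x, l) ∉ B) hB.compl]
    filter_upwards [ae_restrict_mem hGm] with x hx
    filter_upwards [ae_restrict_of_ae (hmono x hx).ae_differentiableAt] with l hl
    rintro ⟨⟨y, s⟩, hys, he⟩
    simp only [Prod.map_apply, id, Prod.mk.injEq] at he
    obtain ⟨rfl, rfl⟩ := he
    exact hys hl
  have hrhs : ∫ z in G ×ˢ Ioo (0 : ℝ) 1, deriv (fun s => f z.1 s) z.2 * φ z ∂(μ.prod volume)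
      = ∫ z in G ×ˢ Ioo (0 : ℝ) 1, d z * φ z ∂(μ.prod volume) :=
    setIntegral_congr_fun hQ fun z hz => by
      change deriv (f z.1) z.2 * φ z = d (z.1, z.2) * φ z
      rw [hdeq z.1 hz.1]
  have hint : Integrable (fun z => d z * φ z)
      ((μ.restrict G).prod (volume.restrict (Ioo (0 : ℝ) 1))) := by
    refine Integrable.of_bound (hdm.mul hc.continuous.measurable).aestronglyMeasurable (C * K) ?_
    rw [← restrict_prod_eq μ volume hGm measurableSet_Ioo]
    filter_upwards [ae_restrict_mem hQ] with z hz
    have h1 : 0 ≤ d z := (hdeq z.1 hz.1 z.2).symm ▸ (hmono z.1 hz.1).deriv_nonneg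
    have h2 : d z ≤ C := (hdeq z.1 hz.1 z.2).symm ▸ hC z.1 hz.1 z.2 hz.2
    rw [norm_mul, Real.norm_of_nonneg h1]
    exact mul_le_mul h2 (hK z) (norm_nonneg _) (h1.trans h2)
  rw [hrhs]
  by_cases hgrad : Integrable
      (fun z : M × ℝ => F.innerGrad (fun x => f x z.2) (fun x => φ (x, z.2)) z.1)
      ((μ.prod volume).restrict (G ×ˢ Ioo (0 : ℝ) 1))
  · rw [restrict_prod_eq μ volume hGm measurableSet_Ioo] at hgrad ⊢
    rw [integral_prod_symm _ hgrad, integral_prod_symm _ hint, ← integral_neg]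
    refine integral_mono_ae hgrad.integral_prod_right.neg hint.integral_prod_right ?_
    filter_upwards [hae, hint.prod_left_ae, ae_restrict_mem measurableSet_Ioo] with l hl hil hlI
    refine (hsup l hlI _ (hφs l) fun x => hφ0 _).trans ?_
    refine integral_mono_of_nonneg ?_ hil ?_
    · filter_upwards [ae_restrict_mem hGm] with x hx using mul_nonneg (hh x hx l) (hφ0 _)
    · filter_upwards [ae_restrict_mem hGm, hl] with x hx hxB
      rw [hdeq x hx]
      exact mul_le_mul_of_nonneg_right (hle x hx l (hBmem x hx l hxB)) (hφ0 _)
  · rw [integral_undef hgrad, neg_zero]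
    refine setIntegral_nonneg hQ fun z hz => mul_nonneg ?_ (hφ0 z)
    exact (hdeq z.1 hz.1 z.2).symm ▸ (hmono z.1 hz.1).deriv_nonneg

/-- Proposition 6.12. With `Ω'' ⊂⊂ Ω'`,
`t₀ = dist²(Ω'',∂Ω')/(4C_*)`, `C_* = 2 osc_{cl Ω'} u + 2`, and `t₁ > 0` such that
`f_t(·,λ)` is a super-solution of `𝓛 = -e^{-2nkλ}(nk/t)L²_{t,λ}·vol` on `Ω''` for all
`t ∈ (0,t₁)`, `λ ∈ [0,1]`: for each `t ∈ (0, min{t₀,t₁})` the function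
`(x,λ) ↦ f_t(x,λ)` is a super-solution of the heat equation `𝓛_{f_t} = ∂f_t/∂λ` on the
cylinder `Ω''×(0,1)`. -/
theorem statement_18 (n : ℕ) (k : ℝ) (hk : k ≤ 0)
    {M : Type*} [MetricSpace M] [MeasurableSpace M] [BorelSpace M]
    (hM : AlexandrovSpace M n k)
    {Y : Type*} [MetricSpace Y] (hY : NPCSpace Y)
    (F : SobolevFramework M (μH[(n : ℝ)]))
    (Ω Ω' Ω'' : Set M)
    (hΩo : IsOpen Ω) (hΩc : IsConnected Ω) (hΩb : Bornology.IsBounded Ω)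
    (hΩ'o : IsOpen Ω') (hΩ'c : IsConnected Ω') (hΩ' : CptIn Ω' Ω)
    (hΩ''o : IsOpen Ω'') (hΩ''c : IsConnected Ω'') (hΩ'' : CptIn Ω'' Ω')
    (u : M → Y) (hu : ContinuousOn u Ω) (hharm : IsHarmonicMap F n Ω u)
    (Cstar t₀ : ℝ)
    (hC : Cstar = 2 * oscOn u (closure Ω') + 2)
    (ht₀ : t₀ = setDist Ω'' (frontier Ω') ^ 2 / (4 * Cstar))
    (t₁ : ℝ) (ht₁ : 0 < t₁)
    (hsuper : ∀ t : ℝ, 0 < t → t < t₁ → ∀ l ∈ Set.Icc (0:ℝ) 1,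
      IsSupersolution F Ω''
        (fun x => auxF n k u Ω' t x l)
        (fun x => -(Real.exp (-2 * (n : ℝ) * k * l) * ((n : ℝ) * k / t)
          * auxL n k u Ω' t l x ^ 2))) :
    ∀ t : ℝ, 0 < t → t < min t₀ t₁ →
      IsHeatSupersolution F Ω'' (Set.Ioo (0:ℝ) 1)
        (fun z : M × ℝ => auxF n k u Ω' t z.1 z.2) := by
  intro t ht htt
  have ht1 : t < t₁ := htt.trans_le (min_le_right _ _)
  have := hM.isLocallyFiniteMeasure hk
  have hG : Ω'' ⊆ Ω' := subset_closure.trans hΩ''.2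
  have hO : Ω' ⊆ Ω := subset_closure.trans hΩ'.2
  obtain ⟨R, hR⟩ := isBounded_iff.1 (hΩ'.1.image_of_continuousOn (hu.mono hΩ'.2)).isBounded
  obtain ⟨D, hD⟩ := isBounded_iff.1 hΩ'.1.isBounded
  have hR' : ∀ x ∈ Ω', ∀ y ∈ Ω', dist (u x) (u y) ≤ R := fun x hx y hy =>
    hR (mem_image_of_mem u (subset_closure hx)) (mem_image_of_mem u (subset_closure hy))
  have hD' : ∀ x ∈ Ω', ∀ y ∈ Ω', dist x y ≤ D := fun x hx y hy =>
    hD (subset_closure hx) (subset_closure hy)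
  have hnk : 0 ≤ -2 * (n : ℝ) * k := by nlinarith [n.cast_nonneg (α := ℝ)]
  refine isHeatSupersolution_of_slices F hΩ''o
    ((measure_mono subset_closure).trans_lt hΩ''.1.measure_lt_top)
    (C := Real.exp (-2 * (n : ℝ) * k * 1) * (-2 * (n : ℝ) * k) * D ^ 2 / (2 * t))
    (continuous_auxF ht hR' hD' hG (hu.mono (hG.trans hO)))
    (fun x hx => monotone_auxF hk ht hR' (hG hx)) (fun x hx l hl => ?_) (fun x _ l => ?_)
    (fun x hx l hd => auxL_sq_le_deriv_auxF hk ht hR' (hG hx) hd)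
    (fun l hl => hsuper t ht ht1 l (Ioo_subset_Icc_self hl))
  · refine (deriv_auxF_le hk ht hR' hD' (hG hx) l).trans ?_
    have := hl.2.le
    gcongr
  · have h1 : 0 ≤ -((n : ℝ) * k / t) := by
      rw [← neg_div]
      have : 0 ≤ -((n : ℝ) * k) := by linarith
      positivity
    rw [← neg_mul, ← mul_neg]
    positivity

end Paper
end
end
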